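/- arXiv:2308.12405 — 6 statements merged into one kernel-verified Lean document; each statement's English description precedes it below -/
import Mathlib

section
/- Let S1 and S2 be disjoint nonempty subsets of Σ^n, and suppose α = x·a_2⋯a_n ∈ S1 and α̂ = y·a_2⋯a_n ∈ S2 where x and y are distinct symbols of Σ (so (α, α̂) is a conjugate pair). If U1 is a word of length |S1| that, read cyclically, is a universal cycle for S1 and that has suffix α (as a word), and U2 is a word of length |S2| that, read cyclically, is a universal cycle for S2 and that has suffix α̂, then the concatenation U1·U2, read cyclically, is a universal cycle for S1 ∪ S2. -/
/-- The cyclic length-`n` window of `U` starting at position `i` (0-indexed). -/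
def cycWindow {A : Type*} (U : List A) (n i : ℕ) (h : 0 < U.length) : List A :=
  (List.range n).map fun j => U.get ⟨(i + j) % U.length, Nat.mod_lt _ h⟩

/-- `U`, read cyclically, is a universal cycle for the finite set `S` of words of
length `n`: the `|U|` cyclic windows of length `n` are exactly the elements of `S`,
each occurring exactly once (so in particular `|U| = |S|`). -/
def IsUCycle {A : Type*} (n : ℕ) (S : Finset (List A)) (U : List A) : Prop :=
  ∃ h : 0 < U.length,
    (((List.range U.length).map fun i => cycWindow U n i h : List (List A)) : Multiset (List A))
      = S.val

theorem IsUCycle.rotate {A : Type*} {n : ℕ} {S : Finset (List A)} {U : List A}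
    (hU : IsUCycle n S U) (r : ℕ) : IsUCycle n S (U.rotate r) := by
  obtain ⟨h, hS⟩ := hU
  have h' : 0 < (U.rotate r).length := by rwa [List.length_rotate]
  refine ⟨h', ?_⟩
  rw [← hS, Multiset.coe_eq_coe]
  have key : ((List.range (U.rotate r).length).map fun i => cycWindow (U.rotate r) n i h') =
      ((List.range U.length).map fun i => cycWindow U n i h).rotate r := by
    apply List.ext_getElem
    · simp
    · intro i _ _
      simp only [List.getElem_rotate, List.getElem_map, List.getElem_range, cycWindow,
        List.length_map, List.length_range, List.get_eq_getElem, List.length_rotate]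
      refine List.map_congr_left fun j _ => ?_
      congr 1
      simp only [Nat.mod_add_mod]
      congr 1
      ring
  rw [key]
  exact List.rotate_perm _ _

theorem IsUCycle.append_comm {A : Type*} {n : ℕ} {S : Finset (List A)} {U V : List A}
    (h : IsUCycle n S (U ++ V)) : IsUCycle n S (V ++ U) := by
  have h' := h.rotate U.length
  rwa [List.rotate_append_length_eq] at h'

/-- Cyclic words sharing a prefix of length at least `n - 1` can be concatenated without
changing the windows of length `n`. -/
theorem IsUCycle.append_of_common_prefix {A : Type*} [DecidableEq A] {n : ℕ}
    {S T : Finset (List A)} (hdisj : Disjoint S T) {w P Q : List A} (hw : n ≤ w.length + 1)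
    (hP : IsUCycle n S (w ++ P)) (hQ : IsUCycle n T (w ++ Q)) :
    IsUCycle n (S ∪ T) ((w ++ P) ++ (w ++ Q)) := by
  obtain ⟨h1, hS⟩ := hP
  obtain ⟨h2, hT⟩ := hQ
  have h : 0 < ((w ++ P) ++ (w ++ Q)).length := by
    rw [List.length_append]
    exact Nat.add_pos_left h1 _
  refine ⟨h, ?_⟩
  rw [← Finset.disjUnion_eq_union _ _ hdisj, Finset.disjUnion_val, ← hS, ← hT,
    Multiset.coe_add, Multiset.coe_eq_coe, List.length_append (as := w ++ P), List.range_add,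
    List.map_append, List.map_map]
  have hpre : ∀ t (ht : t < w.length) (R : List A) (hR : t < (w ++ R).length),
      (w ++ R)[t] = w[t] := fun t ht R _ => List.getElem_append_left ht
  apply List.Perm.of_eq
  congr 1
  · refine List.map_congr_left fun i hi => List.map_congr_left fun j hj => ?_
    rw [List.mem_range] at hi hj
    simp only [List.get_eq_getElem]
    by_cases hlt : i + j < (w ++ P).length
    · have e : (i + j) % ((w ++ P) ++ (w ++ Q)).length = i + j :=
        Nat.mod_eq_of_lt (by rw [List.length_append]; omega)
      simp only [e, Nat.mod_eq_of_lt hlt]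
      exact List.getElem_append_left hlt
    · obtain ⟨t, ht⟩ := Nat.exists_eq_add_of_le (not_lt.mp hlt)
      have htw : t < w.length := by omega
      have hP' : t < (w ++ P).length := by rw [List.length_append]; omega
      have hQ' : t < (w ++ Q).length := by rw [List.length_append]; omega
      have e : (i + j) % ((w ++ P) ++ (w ++ Q)).length = (w ++ P).length + t := by
        rw [ht]
        exact Nat.mod_eq_of_lt (by rw [List.length_append (as := w ++ P)]; omega)
      have e' : (i + j) % (w ++ P).length = t := by
        rw [ht, Nat.add_mod_left, Nat.mod_eq_of_lt hP']
      simp only [e, e']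
      rw [List.getElem_append_right (Nat.le_add_right _ _)]
      simp only [Nat.add_sub_cancel_left]
      rw [hpre t htw, hpre t htw]
  · refine List.map_congr_left fun i hi => List.map_congr_left fun j hj => ?_
    rw [List.mem_range] at hi hj
    simp only [List.get_eq_getElem]
    by_cases hlt : i + j < (w ++ Q).length
    · have e : ((w ++ P).length + i + j) % ((w ++ P) ++ (w ++ Q)).length
          = (w ++ P).length + (i + j) := by
        rw [Nat.add_assoc]
        exact Nat.mod_eq_of_lt (by rw [List.length_append (as := w ++ P)]; omega)
      simp only [e, Nat.mod_eq_of_lt hlt]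
      rw [List.getElem_append_right (Nat.le_add_right _ _)]
      simp only [Nat.add_sub_cancel_left]
    · obtain ⟨t, ht⟩ := Nat.exists_eq_add_of_le (not_lt.mp hlt)
      have htw : t < w.length := by omega
      have hP' : t < (w ++ P).length := by rw [List.length_append]; omega
      have hQ' : t < (w ++ Q).length := by rw [List.length_append]; omega
      have e : ((w ++ P).length + i + j) % ((w ++ P) ++ (w ++ Q)).length = t := by
        rw [Nat.add_assoc, ht, ← Nat.add_assoc, ← List.length_append (as := w ++ P),
          Nat.add_mod_left]
        exact Nat.mod_eq_of_lt (by rw [List.length_append (as := w ++ P)]; omega)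
      have e' : (i + j) % (w ++ Q).length = t := by
        rw [ht, Nat.add_mod_left, Nat.mod_eq_of_lt hQ']
      simp only [e, e']
      rw [List.getElem_append_left hP', hpre t htw, hpre t htw]

theorem stmt0 {k n : ℕ} (hk : 2 ≤ k) (hn : 1 ≤ n)
    (S1 S2 : Finset (List (Fin k)))
    (hS1n : ∀ w ∈ S1, w.length = n) (hS2n : ∀ w ∈ S2, w.length = n)
    (hne1 : S1.Nonempty) (hne2 : S2.Nonempty)
    (hdisj : Disjoint S1 S2)
    (x y : Fin k) (w : List (Fin k)) (hxy : x ≠ y)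
    (hmem1 : x :: w ∈ S1) (hmem2 : y :: w ∈ S2)
    (U1 U2 : List (Fin k))
    (hU1 : IsUCycle n S1 U1) (hU2 : IsUCycle n S2 U2)
    (hsuf1 : (x :: w) <:+ U1) (hsuf2 : (y :: w) <:+ U2) :
    IsUCycle n (S1 ∪ S2) (U1 ++ U2) := by
  obtain ⟨P, rfl⟩ := hsuf1
  obtain ⟨Q, rfl⟩ := hsuf2
  have hw : n ≤ w.length + 1 := (hS1n _ hmem1).ge
  have h1 : IsUCycle n S1 (w ++ (P ++ [x])) := by
    apply IsUCycle.append_comm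
    simpa using hU1
  have h2 : IsUCycle n S2 (w ++ (Q ++ [y])) := by
    apply IsUCycle.append_comm
    simpa using hU2
  have h := h1.append_of_common_prefix hdisj hw h2
  rw [List.append_assoc] at h
  simpa using h.append_comm
end

section
/- If α = a_1a_2⋯a_n ∈ Σ^n is a necklace, then for all indices 1 ≤ i < j ≤ n and every symbol x ∈ Σ with x < a_i, the word β = a_j⋯a_n a_1⋯a_{i−1} x a_{i+1}⋯a_{j−1} (of length n) is not a necklace. -/
/-- A necklace: a word that is lexicographically less than or equal to
every one of its rotations. -/
def IsNecklace {A : Type*} [LinearOrder A] (α : List A) : Prop :=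
  ∀ i : ℕ, ¬ List.Lex (· < ·) (α.rotate i) α

theorem List.isPrefix_of_not_append_lt {A : Type*} [LinearOrder A] {s t : List A} :
    ∀ {u w : List A}, ¬ w < u ++ s → ¬ u ++ t < w → u <+: w
  | [], _, _, _ => List.nil_prefix
  | _ :: _, [], h, _ => absurd (List.nil_lt_cons _ _) h
  | b :: u, c :: w, h₁, h₂ => by
    rw [List.cons_append, List.cons_lt_cons_iff] at h₁ h₂
    push Not at h₁ h₂
    obtain rfl : b = c := le_antisymm h₁.1 h₂.1
    exact List.cons_prefix_cons.2 ⟨rfl, List.isPrefix_of_not_append_lt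
      (not_lt.2 (h₁.2 rfl)) (not_lt.2 (h₂.2 rfl))⟩

theorem IsNecklace.not_append_lt {A : Type*} [LinearOrder A] {u v : List A}
    (h : IsNecklace (u ++ v)) : ¬ v ++ u < u ++ v := by
  have := h u.length
  rwa [List.rotate_append_length_eq] at this

theorem IsNecklace.not_isNecklace_of_lt {A : Type*} [LinearOrder A] {P Q R : List A} {a x : A}
    (h : IsNecklace (P ++ a :: Q ++ R)) (hR : R ≠ []) (hx : x < a) :
    ¬ IsNecklace (R ++ P ++ x :: Q) := by
  intro h'
  have h₁ : ¬ R ++ P ++ a :: Q < P ++ a :: Q ++ R := by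
    simpa only [List.append_assoc] using h.not_append_lt
  have h₂ : ¬ P ++ x :: Q ++ R < R ++ P ++ x :: Q := by
    rw [List.append_assoc R] at h' ⊢
    exact h'.not_append_lt
  have hlt : P ++ x :: Q ++ R < P ++ a :: Q ++ R := by
    simp only [List.append_assoc, List.cons_append]
    exact List.Lex.append_left _ (List.Lex.rel hx) P
  have hpx := List.isPrefix_of_not_append_lt h₂ fun hh => h₁ (hh.trans hlt)
  have hpa := List.isPrefix_of_not_append_lt (fun hh => h₂ (hlt.trans hh)) h₁
  have hl : P.length < (R ++ P).length := by
    have := List.length_pos_iff.2 hR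
    simp only [List.length_append]
    omega
  have ex := hpx.getElem hl
  have ea := hpa.getElem hl
  simp only [List.append_assoc P, List.cons_append, List.getElem_append_right le_rfl,
    Nat.sub_self, List.getElem_cons_zero] at ex ea
  exact hx.ne (ex.symm.trans ea)

theorem stmt2 {k n : ℕ} (hk : 2 ≤ k) (hn : 1 ≤ n)
    (α : List (Fin k)) (hlen : α.length = n) (hneck : IsNecklace α)
    (i j : ℕ) (hij : i < j) (hj : j < n)
    (ai : Fin k) (hai : α[i]? = some ai)
    (x : Fin k) (hx : x < ai) :
    ¬ IsNecklace (α.drop j ++ α.take i ++ x :: (α.take j).drop (i + 1)) := by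
  have hi : i < (α.take j).length := by
    rw [List.length_take]
    omega
  have hget : (α.take j)[i] = ai := by
    rw [List.getElem_take]
    exact (List.getElem?_eq_some_iff.1 hai).2
  have hα : α.take i ++ ai :: (α.take j).drop (i + 1) ++ α.drop j = α := by
    rw [← hget, ← List.drop_eq_getElem_cons hi,
      show α.take i = (α.take j).take i by rw [List.take_take, min_eq_left hij.le],
      List.take_append_drop, List.take_append_drop]
  refine IsNecklace.not_isNecklace_of_lt (a := ai) (by rwa [hα]) ?_ hx
  rw [Ne, List.drop_eq_nil_iff]
  omega
end

section
/- Let α = a_1a_2⋯a_n be a binary necklace containing at least one 0, and let j be the largest index with a_j = 0 (the last 0 of α). Then the word a_1⋯a_{j−1} 1 a_{j+1}⋯a_n obtained by flipping the last 0 of α to 1 is a necklace. -/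
theorem lex_rotate_iff_exists {A : Type*} [LinearOrder A] (l : List A) (i : ℕ) :
    List.Lex (· < ·) (l.rotate i) l ↔
      ∃ k, ∃ hk : k < l.length,
        (∀ t, ∀ ht : t < k, l[(t + i) % l.length]'(Nat.mod_lt _ (by omega)) = l[t]) ∧
        l[(k + i) % l.length]'(Nat.mod_lt _ (by omega)) < l[k] := by
  change l.rotate i < l ↔ _
  rw [List.lt_iff_exists]
  simp only [List.length_rotate, lt_irrefl, and_false, false_or, List.getElem_rotate]
  constructor
  · rintro ⟨k, hk, _, h⟩
    exact ⟨k, hk, h⟩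
  · rintro ⟨k, hk, h⟩
    exact ⟨k, hk, hk, h⟩

theorem IsNecklace.getElem_zero_le {A : Type*} [LinearOrder A] {l : List A}
    (h : IsNecklace l) (k : ℕ) (hk : k < l.length) : l[0] ≤ l[k] := by
  by_contra! hlt
  refine h k ((lex_rotate_iff_exists l k).2 ⟨0, by omega, by simp, ?_⟩)
  simpa [Nat.mod_eq_of_lt hk] using hlt

theorem stmt3 {n : ℕ} (hn : 1 ≤ n)
    (α : List Bool) (hlen : α.length = n) (hneck : IsNecklace α)
    (j : ℕ) (hj : j < n)
    (hzero : α[j]? = some false)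
    (hlast : ∀ i, j < i → i < n → α[i]? = some true) :
    IsNecklace (α.set j true) := by
  subst hlen
  have hz : α[j] = false := by simpa [List.getElem?_eq_getElem hj] using hzero
  have hl : ∀ i, j < i → ∀ h : i < α.length, α[i] = true := fun i hi h => by
    simpa [List.getElem?_eq_getElem h] using hlast i hi h
  have htail : ∀ i, j ≤ i → ∀ h : i < α.length, (α.set j true)[i]'(by simpa using h) = true := by
    intro i hi h
    rw [List.getElem_set]
    split_ifs with hij
    · rfl
    · exact hl i (by omega) h
  have h0 : α[0] = false := by
    have := hneck.getElem_zero_le j hj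
    rw [hz] at this
    exact le_bot_iff.1 this
  intro r hlex
  rw [← List.rotate_mod, List.length_set] at hlex
  obtain ⟨i, hi, hir⟩ : ∃ i < α.length, r % α.length = i := ⟨_, Nat.mod_lt _ hn, rfl⟩
  rw [hir, lex_rotate_iff_exists] at hlex
  simp only [List.length_set] at hlex
  obtain ⟨k, hk, heq, hlt⟩ := hlex
  obtain ⟨hb0, hb1⟩ := Bool.lt_iff.1 hlt
  by_cases hij : i < j
  · by_cases hkj : k < j - i
    · refine hneck i ((lex_rotate_iff_exists α i).2 ⟨k, hk, fun t ht => ?_, ?_⟩)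
      · have := heq t ht
        simp only [Nat.mod_eq_of_lt (show t + i < α.length by omega)] at this ⊢
        rwa [List.getElem_set_ne (by omega), List.getElem_set_ne (by omega)] at this
      · simp only [Nat.mod_eq_of_lt (show k + i < α.length by omega)] at hlt ⊢
        rwa [List.getElem_set_ne (by omega), List.getElem_set_ne (by omega)] at hlt
    · have hne : α[j - i] = true := by
        have hi0 : i ≠ 0 := by
          rintro rfl
          simp [Nat.mod_eq_of_lt hk] at hlt
        rw [← List.getElem_set_ne (show j ≠ j - i by omega) (a := true) (by simp; omega)]
        rcases Nat.lt_or_ge (j - i) k with h | h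
        · rw [← heq _ h]
          simp [Nat.sub_add_cancel hij.le, Nat.mod_eq_of_lt hj]
        · obtain rfl : k = j - i := by omega
          exact hb1
      refine hneck i ((lex_rotate_iff_exists α i).2 ⟨j - i, by omega, fun t ht => ?_, ?_⟩)
      · have := heq t (by omega)
        simp only [Nat.mod_eq_of_lt (show t + i < α.length by omega)] at this ⊢
        rwa [List.getElem_set_ne (by omega), List.getElem_set_ne (by omega)] at this
      · simp [Nat.sub_add_cancel hij.le, Nat.mod_eq_of_lt hj, hz, hne]
  · have hi1 := htail i (by omega) hi
    rcases Nat.eq_zero_or_pos j with rfl | hjpos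
    · rw [htail _ (Nat.zero_le _) (Nat.mod_lt _ hn)] at hb0
      simp at hb0
    · rcases Nat.eq_zero_or_pos k with rfl | hkpos
      · simp [Nat.mod_eq_of_lt hi, hi1] at hb0
      · have := heq 0 hkpos
        simp only [zero_add, Nat.mod_eq_of_lt hi, hi1] at this
        rw [List.getElem_set_ne (by omega), h0] at this
        simp at this
end

section
/- Let α = a_1a_2⋯a_n be a binary necklace containing at least one 1, and let j be the smallest index with a_j = 1 (the first 1 of α). Then the word a_1⋯a_{j−1} 0 a_{j+1}⋯a_n obtained by flipping the first 1 of α to 0 is a necklace. -/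
theorem List.lex_iff_exists_of_length_eq {l₁ l₂ : List Bool} (h : l₁.length = l₂.length) :
    List.Lex (· < ·) l₁ l₂ ↔ ∃ k, k < l₂.length ∧ (∀ m < k, l₁[m]? = l₂[m]?) ∧
      l₁[k]? = some false ∧ l₂[k]? = some true := by
  change l₁ < l₂ ↔ _
  rw [List.lt_iff_exists]
  constructor
  · rintro (⟨-, hlt⟩ | ⟨k, h₁, h₂, heq, hlt⟩)
    · omega
    · refine ⟨k, h₂, fun m hm => ?_, ?_⟩
      · rw [List.getElem?_eq_getElem (by omega), List.getElem?_eq_getElem (by omega), heq m hm]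
      · rw [List.getElem?_eq_getElem h₁, List.getElem?_eq_getElem h₂]
        simpa [Bool.lt_iff] using hlt
  · rintro ⟨k, hk, heq, h₁, h₂⟩
    refine Or.inr ⟨k, by omega, hk, fun m hm => ?_, ?_⟩
    · have := heq m hm
      rwa [List.getElem?_eq_getElem (by omega), List.getElem?_eq_getElem (by omega),
        Option.some_inj] at this
    · rw [List.getElem?_eq_getElem (by omega), Option.some_inj] at h₁ h₂
      rw [h₁, h₂]
      decide

theorem stmt4 {n : ℕ} (hn : 1 ≤ n)
    (α : List Bool) (hlen : α.length = n) (hneck : IsNecklace α)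
    (j : ℕ) (hj : j < n)
    (hone : α[j]? = some true)
    (hfirst : ∀ i, i < j → α[i]? = some false) :
    IsNecklace (α.set j false) := by
  subst hlen
  intro i hlex
  rw [← List.rotate_mod, List.length_set] at hlex
  have hi : i % α.length < α.length := Nat.mod_lt _ hn
  generalize i % α.length = i at hlex hi
  rw [List.lex_iff_exists_of_length_eq (by simp)] at hlex
  obtain ⟨k, hk, heq, hzero, hk_one⟩ := hlex
  rw [List.length_set] at hk
  have hprefix : ∀ m ≤ j, (α.set j false)[m]? = some false := by
    intro m hm
    rcases hm.lt_or_eq with hm | rfl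
    · rw [List.getElem?_set_ne hm.ne', hfirst m hm]
    · exact List.getElem?_set_self hj
  have hjk : j < k := by
    by_contra! hkj
    simp [hprefix k hkj] at hk_one
  have hrot : ∀ m < α.length, ((α.set j false).rotate i)[m]? =
      (α.set j false)[(m + i) % α.length]? := by
    intro m hm
    rw [List.getElem?_rotate (by simpa using hm), List.length_set]
  by_cases hij : i ≤ j
  · have hall : ∀ m ≤ k, (α.set j false)[m]? = some false := by
      intro m
      induction m using Nat.strong_induction_on with
      | _ m ih =>
        intro hm
        by_cases hmj : m ≤ j
        · exact hprefix m hmj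
        · rcases Nat.eq_zero_or_pos i with rfl | hi_pos
          · rw [hrot k hk, Nat.add_zero, Nat.mod_eq_of_lt hk, hk_one] at hzero
            simp at hzero
          · have hshift := heq (m - i) (by omega)
            rw [hrot _ (by omega), Nat.sub_add_cancel (by omega),
              Nat.mod_eq_of_lt (by omega)] at hshift
            rw [hshift]
            exact ih _ (by omega) (by omega)
    simp [hall k le_rfl] at hk_one
  · have hwindow : ∀ m ≤ j, (α.rotate i)[m]? = some false := by
      intro m hm
      have hne : j ≠ (m + i) % α.length := by
        by_cases hw : m + i < α.length
        · rw [Nat.mod_eq_of_lt hw]; omega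
        · rw [Nat.mod_eq_sub_mod (by omega), Nat.mod_eq_of_lt (by omega)]; omega
      have hmk := heq m (by omega)
      rw [hrot m (by omega), hprefix m hm, List.getElem?_set_ne hne] at hmk
      rw [List.getElem?_rotate (by omega), hmk]
    refine hneck i ((List.lex_iff_exists_of_length_eq (by simp)).2 ⟨j, hj, fun m hm => ?_, ?_, hone⟩)
    · rw [hwindow m hm.le, hfirst m hm]
    · exact hwindow j le_rfl
end

section
/- (Successor-rule content of the theorem for subtrees of the 'last 0' cycle-joining tree T1.) Let N be a set of binary necklaces of length n such that 1^n ∈ N and, for every α ∈ N with α ≠ 1^n, the word obtained from α by flipping its last 0 (the 0 of largest index) to 1 belongs to N. Let S = S_N. For a_1a_2⋯a_n ∈ S, let j be the smallest index with j > 1 and a_j = 0 (j = n+1 if a_2⋯a_n = 1^{n−1}) and let γ = a_j a_{j+1}⋯a_n 0 1^{j−2} (a word of length n). Define f(a_1⋯a_n) to be the complement of a_1 if γ is a necklace and a_2⋯a_n ā_1 ∈ S, and a_1 otherwise. Then the map g(a_1a_2⋯a_n) = a_2⋯a_n f(a_1a_2⋯a_n) maps S into S and acts as a single cycle on S: for all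 σ, τ ∈ S there exists m ≥ 0 with g^{(m)}(σ) = τ. Equivalently, f is the successor rule of a universal cycle for S. -/
/-- The rotation class of `α`: the set of all rotations of `α`. -/
def rotClass {A : Type*} [DecidableEq A] (α : List A) : Finset (List A) :=
  ((List.range α.length).map α.rotate).toFinset

/-- `S_N`: the set of all rotations of all members of `N`. -/
def SN (N : Finset (List Bool)) : Finset (List Bool) :=
  N.biUnion rotClass

open scoped Classical in
/-- The shift map `g(a₁a₂⋯aₙ) = a₂⋯aₙ f(a₁a₂⋯aₙ)` for the successor rule `f` of the
'last 0' tree: letting `j > 1` be the smallest (1-based) index with `a_j = 0`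
(`j = n+1` if none) and `γ = a_j⋯a_n 0 1^{j-2}`, we have `f = ā₁` if `γ` is a necklace
and `a₂⋯aₙā₁ ∈ S`, and `f = a₁` otherwise. -/
noncomputable def gLastZero (S : Finset (List Bool)) (w : List Bool) : List Bool :=
  let m := 1 + ((w.drop 1).takeWhile (fun b => b)).length
  let γ := w.drop m ++ false :: List.replicate (m - 1) true
  let b := if IsNecklace γ ∧ w.drop 1 ++ [!w.headI] ∈ S then !w.headI else w.headI
  w.drop 1 ++ [b]

theorem IsNecklace.eq_of_isRotated {A : Type*} [LinearOrder A] {α β : List A}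
    (hα : IsNecklace α) (hβ : IsNecklace β) (h : α ~r β) : α = β := by
  obtain ⟨j, hj⟩ := h.symm
  obtain ⟨i, hi⟩ := h
  have h₁ : ¬ β < α := fun hlt => hα i (by rw [hi]; exact hlt)
  have h₂ : ¬ α < β := fun hlt => hβ j (by rw [hj]; exact hlt)
  exact le_antisymm (not_lt.mp h₁) (not_lt.mp h₂)

theorem mem_rotClass {A : Type*} [DecidableEq A] {α u : List A} (hα : α ≠ []) :
    u ∈ rotClass α ↔ α ~r u := by
  simp only [rotClass, List.mem_toFinset, List.mem_map, List.mem_range]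
  constructor
  · rintro ⟨i, -, h⟩
    exact ⟨i, h⟩
  · rintro ⟨i, h⟩
    exact ⟨i % α.length, Nat.mod_lt _ (List.length_pos_iff.mpr hα), by rw [List.rotate_mod, h]⟩

theorem mem_SN {N : Finset (List Bool)} (hN : ∀ α ∈ N, α ≠ []) {u : List Bool} :
    u ∈ SN N ↔ ∃ α ∈ N, α ~r u := by
  simp only [SN, Finset.mem_biUnion]
  exact exists_congr fun α => and_congr_right fun hα => mem_rotClass (hN α hα)

theorem exists_eq_replicate_true_append (t : List Bool) :
    ∃ k s, t = List.replicate k true ++ s ∧ s.head? ≠ some true := by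
  induction t with
  | nil => exact ⟨0, [], by simp⟩
  | cons b t ih =>
    obtain ⟨k, s, rfl, hs⟩ := ih
    cases b
    · exact ⟨0, false :: (List.replicate k true ++ s), by simp⟩
    · exact ⟨k + 1, s, by simp [List.replicate_succ], hs⟩

theorem eq_replicate_true_or_exists_last_false (t : List Bool) :
    t = List.replicate t.length true ∨ ∃ k s, t = s ++ false :: List.replicate k true := by
  induction t with
  | nil => simp
  | cons b t ih =>
    rcases ih with h | ⟨k, s, rfl⟩
    · cases b
      · exact .inr ⟨t.length, [], by simpa using h⟩
      · left
        simpa [List.replicate_succ] using h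
    · exact .inr ⟨k, b :: s, rfl⟩

theorem append_false_replicate_true_inj {s s' : List Bool} {k k' : ℕ}
    (h : s ++ false :: List.replicate k true = s' ++ false :: List.replicate k' true) :
    s = s' ∧ k = k' := by
  induction s generalizing s' with
  | nil =>
    cases s' with
    | nil => simpa using h
    | cons b s' =>
      simp only [List.nil_append, List.cons_append, List.cons.injEq] at h
      have : false ∈ List.replicate k true := by rw [h.2]; simp
      simp at this
  | cons a s ih =>
    cases s' with
    | nil =>
      simp only [List.nil_append, List.cons_append, List.cons.injEq] at h
      have : false ∈ List.replicate k' true := by rw [← h.2]; simp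
      simp at this
    | cons b s' =>
      simp only [List.cons_append, List.cons.injEq] at h
      obtain ⟨rfl, rfl⟩ := ih h.2
      simp [h.1]

theorem IsNecklace.head?_ne_true {s t : List Bool} (h : IsNecklace (s ++ false :: t)) :
    s.head? ≠ some true := by
  cases s with
  | nil => simp
  | cons b s =>
    rintro hb
    obtain rfl : b = true := by simpa using hb
    apply h (true :: s).length
    rw [List.rotate_append_length_eq]
    exact List.Lex.rel (by decide)

open scoped Classical in
theorem gLastZero_cons (S : Finset (List Bool)) (b : Bool) (k : ℕ) {s : List Bool}
    (hs : s.head? ≠ some true) :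
    gLastZero S (b :: (List.replicate k true ++ s)) =
      List.replicate k true ++ s ++
        [if IsNecklace (s ++ false :: List.replicate k true) ∧
          List.replicate k true ++ s ++ [!b] ∈ S then !b else b] := by
  have htw : (List.replicate k true ++ s).takeWhile (fun b => b) = List.replicate k true := by
    rw [List.takeWhile_append_of_pos (by simp)]
    rcases s with _ | ⟨_ | _, s⟩ <;> simp_all
  have hdrop : (b :: (List.replicate k true ++ s)).drop (1 + k) = s := by
    rw [Nat.add_comm, List.drop_succ_cons]
    exact List.drop_left' (by simp)
  simp [gLastZero, htw, hdrop]

theorem gLastZero_mem_SN {N : Finset (List Bool)} (hN : ∀ α ∈ N, α ≠ []) {u : List Bool}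
    (hu : u ∈ SN N) : gLastZero (SN N) u ∈ SN N := by
  rw [mem_SN hN] at hu
  obtain ⟨α, hα, hr⟩ := hu
  rcases u with _ | ⟨b, t⟩
  · exact absurd (List.isRotated_nil_iff.mp hr) (hN α hα)
  obtain ⟨k, s, rfl, hs⟩ := exists_eq_replicate_true_append t
  rw [gLastZero_cons _ _ _ hs]
  split_ifs with h
  · exact h.2
  · exact (mem_SN hN).mpr ⟨α, hα, hr.trans ⟨1, by simp⟩⟩

theorem isRotated_cons_append_singleton {A : Type*} (b : A) (t : List A) :
    (b :: t) ~r (t ++ [b]) :=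
  ⟨1, by simp⟩

theorem isRotated_cons_append_comm {A : Type*} (b : A) (s t : List A) :
    (s ++ b :: t) ~r (b :: (t ++ s)) :=
  ⟨s.length, by rw [List.rotate_append_length_eq]; rfl⟩

/-- Reachability under iteration of `f`. -/
def Reaches {A : Type*} (f : A → A) (a b : A) : Prop :=
  ∃ m : ℕ, f^[m] a = b

namespace Reaches

variable {A : Type*} {f : A → A} {a b c : A}

theorem refl (f : A → A) (a : A) : Reaches f a a := ⟨0, rfl⟩

theorem trans (hab : Reaches f a b) (hbc : Reaches f b c) : Reaches f a c := by
  obtain ⟨m, rfl⟩ := hab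
  obtain ⟨k, rfl⟩ := hbc
  exact ⟨k + m, Function.iterate_add_apply f k m a⟩

theorem step (h : f a = b) : Reaches f a b := ⟨1, h⟩

end Reaches

section RotationCycle

variable {A : Type*} {f : List A → List A} {w u : List A}

theorem reaches_from_rotate_one (hf : ∀ u, w ~r u → u ≠ w → f u = u.rotate 1) (hu : w ~r u) :
    Reaches f (w.rotate 1) u := by
  have key (k : ℕ) : Reaches f (w.rotate 1) (w.rotate (k + 1)) := by
    induction k with
    | zero => exact .refl f _
    | succ k ih =>
      by_cases h : w.rotate (k + 1) = w
      · rw [← List.rotate_rotate w (k + 1) 1, h]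
        exact .refl f _
      · refine ih.trans (.step ?_)
        rw [hf _ ⟨_, rfl⟩ h, List.rotate_rotate]
  obtain ⟨i, rfl⟩ : w.rotate 1 ~r u := List.IsRotated.trans (List.IsRotated.symm ⟨1, rfl⟩) hu
  rw [List.rotate_rotate, Nat.add_comm]
  exact key i

theorem reaches_of_isRotated (hf : ∀ u, w ~r u → u ≠ w → f u = u.rotate 1) (hu : w ~r u) :
    Reaches f u w := by
  obtain ⟨i, hi⟩ := hu.symm
  induction i generalizing u with
  | zero => exact ⟨0, by simpa using hi⟩
  | succ i ih =>
    by_cases h : u = w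
    · exact h ▸ .refl f _
    · exact (Reaches.step (hf u hu h)).trans
        (ih (hu.trans ⟨1, rfl⟩) (by rw [List.rotate_rotate, Nat.add_comm, hi]))

end RotationCycle

/-- Joining a rotation cycle through `w` to a cycle on `S` by exchanging the successors
of `w` and of `v ∈ S`. -/
theorem reaches_of_join {A : Type*} {f g : List A → List A} {S : Set (List A)} {w v : List A}
    (hv : v ∈ S) (hgS : g v ∈ S) (hg : ∀ σ ∈ S, ∀ τ ∈ S, Reaches g σ τ) (hmaps : ∀ σ ∈ S, g σ ∈ S)
    (hfg : ∀ u ∈ S, u ≠ v → f u = g u) (hfv : f v = w.rotate 1) (hfw : f w = g v)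
    (hf : ∀ u, w ~r u → u ≠ w → f u = u.rotate 1) {σ τ : List A}
    (hσ : σ ∈ S ∨ w ~r σ) (hτ : τ ∈ S ∨ w ~r τ) : Reaches f σ τ := by
  have hstep {u : List A} (hu : u ∈ S) : Reaches f u (g u) := by
    by_cases h : u = v
    · subst h
      exact (Reaches.step hfv).trans
        ((reaches_from_rotate_one hf (List.IsRotated.refl w)).trans (.step hfw))
    · exact .step (hfg u hu h)
  have hS {σ τ : List A} (hσ : σ ∈ S) (hτ : τ ∈ S) : Reaches f σ τ := by
    obtain ⟨m, hm⟩ := hg σ hσ τ hτ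
    clear hτ
    induction m generalizing σ with
    | zero => exact ⟨0, hm⟩
    | succ m ih => exact (hstep hσ).trans (ih (hmaps σ hσ) hm)
  have hto : Reaches f σ v := by
    rcases hσ with h | h
    · exact hS h hv
    · exact (reaches_of_isRotated hf h).trans ((Reaches.step hfw).trans (hS hgS hv))
  refine hto.trans ?_
  rcases hτ with h | h
  · exact hS hv h
  · exact (Reaches.step hfv).trans (reaches_from_rotate_one hf h)

section Join

variable {N : Finset (List Bool)} {k : ℕ} {s : List Bool}

theorem gLastZero_eq_rotate_one (hN : ∀ α ∈ N, α ≠ [])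
    (hneck : IsNecklace (s ++ false :: List.replicate k true))
    (hmin : ∀ α ∈ N, (s ++ false :: List.replicate k true).count true ≤ α.count true)
    {u : List Bool} (hu : s ++ false :: List.replicate k true ~r u)
    (hne : u ≠ false :: (List.replicate k true ++ s)) :
    gLastZero (SN N) u = u.rotate 1 := by
  rcases u with _ | ⟨b, t⟩
  · simpa using List.isRotated_nil_iff.mp hu
  obtain ⟨k', s', rfl, hs'⟩ := exists_eq_replicate_true_append t
  rw [gLastZero_cons _ _ _ hs', if_neg]
  · simp
  rintro ⟨hneck', hmem⟩
  obtain ⟨α, hα, hr⟩ := (mem_SN hN).mp hmem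
  cases b
  · have := append_false_replicate_true_inj
      (hneck.eq_of_isRotated hneck' (hu.trans (isRotated_cons_append_comm _ _ _).symm))
    exact hne (by rw [this.1, this.2])
  · have h₁ := hmin α hα
    have h₂ := hu.perm.count_eq true
    have h₃ := hr.perm.count_eq true
    simp only [List.count_append, List.count_cons, List.count_nil] at h₁ h₂ h₃
    simp at h₁ h₂ h₃
    omega

theorem gLastZero_erase_eq (hN : ∀ α ∈ N, α ≠ [])
    (hneck : IsNecklace (s ++ false :: List.replicate k true))
    (hmin : ∀ α ∈ N, (s ++ false :: List.replicate k true).count true ≤ α.count true)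
    {u : List Bool} (hu : u ∈ SN (N.erase (s ++ false :: List.replicate k true)))
    (hne : u ≠ true :: (List.replicate k true ++ s)) :
    gLastZero (SN N) u = gLastZero (SN (N.erase (s ++ false :: List.replicate k true))) u := by
  have hN' : ∀ α ∈ N.erase (s ++ false :: List.replicate k true), α ≠ [] :=
    fun α hα => hN α (Finset.mem_of_mem_erase hα)
  obtain ⟨α, hα, hr⟩ := (mem_SN hN').mp hu
  rcases u with _ | ⟨b, t⟩
  · exact absurd (List.isRotated_nil_iff.mp hr) (hN' α hα)
  obtain ⟨k', s', rfl, hs'⟩ := exists_eq_replicate_true_append t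
  rw [gLastZero_cons _ _ _ hs', gLastZero_cons _ _ _ hs']
  congr 3
  refine propext (and_congr_right fun hneck' => ?_)
  rw [mem_SN hN, mem_SN hN']
  constructor
  · rintro ⟨β, hβ, hrβ⟩
    refine ⟨β, Finset.mem_erase.mpr ⟨?_, hβ⟩, hrβ⟩
    rintro rfl
    cases b
    · have h₁ := hmin α (Finset.mem_of_mem_erase hα)
      have h₂ := hr.perm.count_eq true
      have h₃ := hrβ.perm.count_eq true
      simp only [List.count_append, List.count_cons, List.count_nil] at h₁ h₂ h₃
      simp at h₁ h₂ h₃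
      omega
    · have := append_false_replicate_true_inj (hneck.eq_of_isRotated hneck'
        ((hrβ.trans (isRotated_cons_append_singleton _ _).symm).trans
          (isRotated_cons_append_comm _ _ _).symm))
      exact hne (by rw [this.1, this.2])
  · rintro ⟨β, hβ, hrβ⟩
    exact ⟨β, Finset.mem_of_mem_erase hβ, hrβ⟩

end Join

theorem reaches_gLastZero {n : ℕ} (hn : 1 ≤ n) (N : Finset (List Bool))
    (hNneck : ∀ α ∈ N, α.length = n ∧ IsNecklace α)
    (hroot : List.replicate n true ∈ N)
    (hclosed : ∀ s k, s ++ false :: List.replicate k true ∈ N →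
      s ++ true :: List.replicate k true ∈ N) :
    ∀ σ ∈ SN N, ∀ τ ∈ SN N, Reaches (gLastZero (SN N)) σ τ := by
  induction N using Finset.strongInduction with
  | H N ih =>
  have hN : ∀ α ∈ N, α ≠ [] := by
    rintro α hα rfl
    have := (hNneck _ hα).1
    simp at this
    omega
  obtain ⟨γ, hγ, hmin⟩ := Finset.exists_min_image N (List.count true) ⟨_, hroot⟩
  rcases eq_replicate_true_or_exists_last_false γ with hγ₁ | ⟨k, s, rfl⟩
  · rw [(hNneck γ hγ).1] at hγ₁
    have hall (u) (hu : u ∈ SN N) : u = List.replicate n true := by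
      obtain ⟨α, hα, hr⟩ := (mem_SN hN).mp hu
      have hle := hmin α hα
      rw [hγ₁, List.count_replicate_self, ← (hNneck α hα).1] at hle
      have hαr : α = List.replicate n true := by
        rw [List.eq_replicate_iff]
        refine ⟨(hNneck α hα).1, fun b hb => ?_⟩
        exact ((List.count_eq_length.mp (le_antisymm List.count_le_length hle)) b hb).symm
      obtain ⟨i, rfl⟩ := hr
      rw [hαr, List.rotate_replicate]
    intro σ hσ τ hτ
    rw [hall σ hσ, hall τ hτ]
    exact .refl _ _
  set γ := s ++ false :: List.replicate k true with hγdef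
  have hneck : IsNecklace γ := (hNneck γ hγ).2
  have hs : s.head? ≠ some true := hneck.head?_ne_true
  have hN' : ∀ α ∈ N.erase γ, α ≠ [] := fun α hα => hN α (Finset.mem_of_mem_erase hα)
  have hcount (α : List Bool) (hα : α ∈ N) (s' k')
      (h : α = s' ++ false :: List.replicate k' true) :
      s' ++ true :: List.replicate k' true ≠ γ := by
    intro h'
    have := hmin α hα
    rw [← h', h] at this
    simp at this
  have hparent : s ++ true :: List.replicate k true ∈ N.erase γ :=
    Finset.mem_erase.mpr ⟨hcount γ hγ s k rfl, hclosed s k hγ⟩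
  have hrot : γ ~r false :: (List.replicate k true ++ s) := isRotated_cons_append_comm _ _ _
  have hv : true :: (List.replicate k true ++ s) ∈ SN (N.erase γ) :=
    (mem_SN hN').mpr ⟨_, hparent, isRotated_cons_append_comm _ _ _⟩
  have hmem₁ : List.replicate k true ++ s ++ [true] ∈ SN (N.erase γ) :=
    (mem_SN hN').mpr ⟨_, hparent,
      (isRotated_cons_append_comm _ _ _).trans (isRotated_cons_append_singleton _ _)⟩
  have hsub {u : List Bool} : u ∈ SN N ↔ u ∈ SN (N.erase γ) ∨ γ ~r u := by
    rw [mem_SN hN, mem_SN hN']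
    constructor
    · rintro ⟨α, hα, hr⟩
      by_cases h : α = γ
      · exact .inr (h ▸ hr)
      · exact .inl ⟨α, Finset.mem_erase.mpr ⟨h, hα⟩, hr⟩
    · rintro (⟨α, hα, hr⟩ | hr)
      · exact ⟨α, Finset.mem_of_mem_erase hα, hr⟩
      · exact ⟨γ, hγ, hr⟩
  have hmem₀ : List.replicate k true ++ s ++ [false] ∈ SN N :=
    hsub.mpr (.inr (hrot.trans (isRotated_cons_append_singleton _ _)))
  have hnmem₀ : List.replicate k true ++ s ++ [false] ∉ SN (N.erase γ) := by
    intro h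
    obtain ⟨α, hα, hr⟩ := (mem_SN hN').mp h
    rw [Finset.mem_erase] at hα
    exact hα.1 ((hNneck α hα.2).2.eq_of_isRotated hneck
      (hr.trans (hrot.trans (isRotated_cons_append_singleton _ _)).symm))
  have hgv : gLastZero (SN (N.erase γ)) (true :: (List.replicate k true ++ s)) =
      List.replicate k true ++ s ++ [true] := by
    rw [gLastZero_cons _ _ _ hs, if_neg fun h => hnmem₀ h.2]
  have hih := ih (N.erase γ) (Finset.erase_ssubset hγ)
    (fun α hα => hNneck α (Finset.mem_of_mem_erase hα))
    (Finset.mem_erase.mpr ⟨fun h => by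
      have : false ∈ List.replicate n true := by rw [h, hγdef]; simp
      simp at this, hroot⟩)
    (fun s' k' h => Finset.mem_erase.mpr
      ⟨hcount _ (Finset.mem_of_mem_erase h) s' k' rfl, hclosed s' k' (Finset.mem_of_mem_erase h)⟩)
  intro σ hσ τ hτ
  refine reaches_of_join (S := {u | u ∈ SN (N.erase γ)}) hv (gLastZero_mem_SN hN' hv) hih
    (fun u hu => gLastZero_mem_SN hN' hu)
    (fun u hu hne => gLastZero_erase_eq hN hneck hmin hu hne)
    (w := false :: (List.replicate k true ++ s)) ?_ ?_
    (fun u hu hne => gLastZero_eq_rotate_one hN hneck hmin (hrot.trans hu) hne)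
    ((hsub.mp hσ).imp id hrot.symm.trans) ((hsub.mp hτ).imp id hrot.symm.trans)
  · rw [gLastZero_cons _ _ _ hs, if_pos ⟨hneck, hmem₀⟩]
    simp
  · rw [hgv, gLastZero_cons _ _ _ hs, if_pos ⟨hneck, hsub.mpr (.inl hmem₁)⟩]
    simp

theorem stmt8 {n : ℕ} (hn : 1 ≤ n)
    (N : Finset (List Bool))
    (hNneck : ∀ α ∈ N, α.length = n ∧ IsNecklace α)
    (hroot : List.replicate n true ∈ N)
    (hclosed : ∀ α ∈ N, α ≠ List.replicate n true → ∀ j, j < n →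
      α[j]? = some false → (∀ i, j < i → i < n → α[i]? = some true) →
      α.set j true ∈ N) :
    (∀ w ∈ SN N, gLastZero (SN N) w ∈ SN N) ∧
    ∀ σ ∈ SN N, ∀ τ ∈ SN N, ∃ m : ℕ, (gLastZero (SN N))^[m] σ = τ := by
  have hN : ∀ α ∈ N, α ≠ [] := by
    rintro α hα rfl
    have := (hNneck _ hα).1
    simp at this
    omega
  refine ⟨fun w hw => gLastZero_mem_SN hN hw, reaches_gLastZero hn N hNneck hroot ?_⟩
  intro s k h
  have hlen := (hNneck _ h).1
  simp only [List.length_append, List.length_cons, List.length_replicate] at hlen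
  have hset := hclosed _ h (fun he => by
      have : false ∈ List.replicate n true := by rw [← he]; simp
      simp at this)
    s.length (by omega) (by simp) (fun i hi hin => by
      obtain ⟨d, rfl⟩ := Nat.exists_eq_add_of_lt hi
      rw [List.getElem?_append_right (by omega)]
      simp [show s.length + d + 1 - s.length = d + 1 by omega, List.getElem?_replicate]
      omega)
  simpa using hset
end

section
/- (Successor-rule content of the theorem for subtrees of the 'last 1' cycle-joining tree T3.) Let N be a set of binary necklaces of length n such that 0^n ∈ N and, for every α ∈ N with α ≠ 0^n, the lexicographically smallest rotation of the word obtained from α by flipping its last 1 (the 1 of largest index) to 0 belongs to N. Let S = S_N. For a_1a_2⋯a_n ∈ S, let γ = a_2a_3⋯a_n 1. Define f(a_1⋯a_n) to be the complement of a_1 if γ is a necklace and a_2⋯a_n ā_1 ∈ S, and a_1 otherwise. Then the map g(a_1a_2⋯a_n) = a_2⋯a_n f(a_1a_2⋯a_n) maps S into S and acts as a single cycle on S: for all σ, τ ∈ S there exists m ≥ 0 with g^{(m)}(σ) = τ. Equivalently, f is the successor rule of a universal cycle for S. -/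
open scoped Classical in
/-- The shift map `g(a₁a₂⋯aₙ) = a₂⋯aₙ f(a₁a₂⋯aₙ)` for the successor rule `f` of the
'last 1' tree: with `γ = a₂a₃⋯aₙ1`, we have `f = ā₁` if `γ` is a necklace and
`a₂⋯aₙā₁ ∈ S`, and `f = a₁` otherwise. -/
noncomputable def gLastOne (S : Finset (List Bool)) (w : List Bool) : List Bool :=
  let γ := w.drop 1 ++ [true]
  let b := if IsNecklace γ ∧ w.drop 1 ++ [!w.headI] ∈ S then !w.headI else w.headI
  w.drop 1 ++ [b]

theorem isNecklace_iff_le_rotate {A : Type*} [LinearOrder A] {α : List A} :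
    IsNecklace α ↔ ∀ i : ℕ, α ≤ α.rotate i :=
  forall_congr' fun i => not_lt (a := α.rotate i) (b := α)

theorem exists_isNecklace_rotate {A : Type*} [LinearOrder A] (w : List A) :
    ∃ i : ℕ, IsNecklace (w.rotate i) := by
  rcases w.length.eq_zero_or_pos with h | h
  · exact ⟨0, by simp [List.length_eq_zero_iff.1 h, isNecklace_iff_le_rotate]⟩
  obtain ⟨i, -, hi⟩ := Finset.exists_min_image (Finset.range w.length) w.rotate
    ⟨0, Finset.mem_range.2 h⟩
  refine ⟨i, isNecklace_iff_le_rotate.2 fun j => ?_⟩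
  rw [List.rotate_rotate, ← List.rotate_mod w (i + j)]
  exact hi _ (Finset.mem_range.2 (Nat.mod_lt _ h))

theorem eq_replicate_of_not_lex_append (v : List Bool)
    (h : ¬ List.Lex (· < ·) (false :: v) (v ++ [false])) :
    v = List.replicate v.length false := by
  induction v with
  | nil => rfl
  | cons a v ih =>
    cases a
    · rw [List.length_cons, List.replicate_succ, ← ih fun h' => h (.cons h')]
    · exact absurd (.rel (by decide)) h

theorem IsNecklace.exists_eq_append_true {n : ℕ} (hn : 1 ≤ n) {α : List Bool}
    (hα : IsNecklace α) (hlen : α.length = n) (h0 : α ≠ List.replicate n false) :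
    ∃ u, α = u ++ [true] := by
  rcases List.eq_nil_or_concat' α with rfl | ⟨u, b, rfl⟩
  · simp at hlen; omega
  cases b
  · refine absurd ?_ h0
    have h := hα u.length
    rw [List.rotate_append_length_eq] at h
    have hu := eq_replicate_of_not_lex_append u h
    rw [← hlen, List.length_append, List.length_singleton, List.replicate_succ', ← hu]
  · exact ⟨u, rfl⟩

theorem mem_SN_iff {N : Finset (List Bool)} {w : List Bool} (hw : w ≠ []) :
    w ∈ SN N ↔ ∃ α ∈ N, α ~r w := by
  simp only [SN, rotClass, Finset.mem_biUnion, List.mem_toFinset, List.mem_map, List.mem_range]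
  refine exists_congr fun α => and_congr_right fun _ => ⟨fun ⟨i, _, h⟩ => ⟨i, h⟩, fun h => ?_⟩
  obtain ⟨i, hi, h'⟩ := List.isRotated_iff_mod.1 h
  have hpos : 0 < α.length := by
    rw [h.perm.length_eq]; exact List.length_pos_iff.2 hw
  exact ⟨i % α.length, Nat.mod_lt _ hpos, by rw [List.rotate_mod, h']⟩

open scoped Classical in
theorem gLastOne_cons {S : Finset (List Bool)}
    (hrot : ∀ w ∈ S, ∀ v, w ~r v → v ∈ S)
    (hdown : ∀ u, IsNecklace (u ++ [true]) → u ++ [true] ∈ S → u ++ [false] ∈ S)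
    {a : Bool} {u : List Bool} (hw : a :: u ∈ S) :
    gLastOne S (a :: u) =
      u ++ [if IsNecklace (u ++ [true]) ∧ u ++ [true] ∈ S then !a else a] := by
  have h1 : u ++ [a] ∈ S := hrot _ hw _ ⟨1, by simp⟩
  have h2 := hdown u
  cases a <;> simp only [gLastOne, List.drop_one, List.tail_cons, List.headI_cons, Bool.not_true,
    Bool.not_false] <;>
    (congr 3; simp; tauto)

/-- Every relation that is reflexive, symmetric and transitive on `S` and contains the steps of
`gLastOne` also contains the steps of the pure rotation. -/
theorem related_rotate_of_related_gLastOne {n : ℕ} {S : Finset (List Bool)}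
    (hlen : ∀ w ∈ S, w.length = n)
    (hrot : ∀ w ∈ S, ∀ v, w ~r v → v ∈ S)
    (hdown : ∀ u, IsNecklace (u ++ [true]) → u ++ [true] ∈ S → u ++ [false] ∈ S)
    {E : List Bool → List Bool → Prop}
    (hrefl : ∀ w ∈ S, E w w) (hsymm : ∀ {x y}, E x y → E y x)
    (htrans : ∀ {x y z}, E x y → E y z → E x z)
    (hg : ∀ w ∈ S, E w (gLastOne S w)) :
    ∀ w ∈ S, E w (w.rotate 1) := by
  classical
  suffices H : ∀ k, ∀ w ∈ S, n - w.count true = k → E w (w.rotate 1) from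
    fun w hw => H _ w hw rfl
  intro k
  induction k using Nat.strong_induction_on with
  | _ k ih =>
  have falseCase : ∀ u, false :: u ∈ S → n - (false :: u).count true = k →
      E (false :: u) (u ++ [false]) := by
    intro u hu hk
    have hgu := hg _ hu
    rw [gLastOne_cons hrot hdown hu] at hgu
    split_ifs at hgu with hP
    · have hS' : true :: u ∈ S := hrot _ hP.2 _ ⟨u.length, by simp⟩
      have hlu := hlen _ hS'
      have hcu := List.count_le_length (a := true) (l := u)
      have h2 := ih (n - (true :: u).count true) (by
        simp only [List.count_cons, List.length_cons] at *
        simp at *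
        omega) _ hS' rfl
      have h3 := hg _ hS'
      rw [gLastOne_cons hrot hdown hS', if_pos hP] at h3
      simp at h2 h3 hgu
      exact htrans hgu (htrans (hsymm h2) h3)
    · exact hgu
  intro w hw hk
  cases w with
  | nil => simpa using hrefl _ hw
  | cons a u =>
  cases a
  · simpa using falseCase u hw hk
  have hgu := hg _ hw
  rw [gLastOne_cons hrot hdown hw] at hgu
  split_ifs at hgu with hP
  swap
  · simpa using hgu
  have key : ∀ i, E (u ++ [true]) ((u ++ [true]).rotate i) ∨ E (u ++ [true]) (true :: u) := by
    intro i
    induction i with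
    | zero => left; simpa using hrefl _ hP.2
    | succ i ihi =>
      rcases ihi with h | h
      swap
      · exact Or.inr h
      rw [← List.rotate_rotate]
      have hr : (u ++ [true]) ~r ((u ++ [true]).rotate i) := ⟨i, rfl⟩
      generalize (u ++ [true]).rotate i = x at *
      have hx : x ∈ S := hrot _ hP.2 _ hr
      cases x with
      | nil => left; simpa using h
      | cons b v =>
      cases b
      · left
        refine htrans h ?_
        have := falseCase v hx (by
          rw [← hr.perm.count_eq, ← hk]; simp)
        simpa using this
      · have h3 := hg _ hx
        rw [gLastOne_cons hrot hdown hx] at h3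
        split_ifs at h3 with hQ
        · right
          have : u ++ [true] = v ++ [true] :=
            hP.1.eq_of_isRotated hQ.1 (hr.trans ⟨1, by simp⟩)
          rw [List.append_left_inj] at this
          rwa [this] at h ⊢
        · left
          refine htrans h ?_
          simpa using h3
  have h4 : E (u ++ [true]) (true :: u) := by
    rcases key u.length with h | h
    · simpa using h
    · exact h
  simpa using hsymm h4

theorem gLastOne_injOn {n : ℕ} (hn : 1 ≤ n) {S : Finset (List Bool)}
    (hlen : ∀ w ∈ S, w.length = n)
    (hrot : ∀ w ∈ S, ∀ v, w ~r v → v ∈ S)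
    (hdown : ∀ u, IsNecklace (u ++ [true]) → u ++ [true] ∈ S → u ++ [false] ∈ S) :
    Set.InjOn (gLastOne S) S := by
  classical
  intro x hx y hy hxy
  cases x with
  | nil => have := hlen _ hx; simp at this; omega
  | cons a u =>
  cases y with
  | nil => have := hlen _ hy; simp at this; omega
  | cons b v =>
  rw [gLastOne_cons hrot hdown hx, gLastOne_cons hrot hdown hy] at hxy
  obtain ⟨rfl, h⟩ := List.append_inj' hxy rfl
  split_ifs at h <;> simpa using h

theorem gLastOne_mem {n : ℕ} (hn : 1 ≤ n) {S : Finset (List Bool)}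
    (hlen : ∀ w ∈ S, w.length = n)
    (hrot : ∀ w ∈ S, ∀ v, w ~r v → v ∈ S)
    (hdown : ∀ u, IsNecklace (u ++ [true]) → u ++ [true] ∈ S → u ++ [false] ∈ S) :
    ∀ w ∈ S, gLastOne S w ∈ S := by
  classical
  intro w hw
  cases w with
  | nil => have := hlen _ hw; simp at this; omega
  | cons a u =>
  rw [gLastOne_cons hrot hdown hw]
  split_ifs with h
  · cases a
    · exact h.2
    · exact hdown u h.1 h.2
  · exact hrot _ hw _ ⟨1, by simp⟩

/-- A self-map that is injective on a finite set, preserving it, moves between any two points that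
every equivalence relation containing its steps identifies. -/
theorem exists_iterate_eq_of_injOn {A : Type*} {S : Finset A} {g : A → A}
    (hmaps : ∀ w ∈ S, g w ∈ S) (hinj : Set.InjOn g S) {σ τ : A}
    (h : ∀ E : A → A → Prop, (∀ w ∈ S, E w w) → (∀ {x y}, E x y → E y x) →
      (∀ {x y z}, E x y → E y z → E x z) → (∀ w ∈ S, E w (g w)) → E σ τ) :
    ∃ m : ℕ, g^[m] σ = τ := by
  let G : S → S := fun w => ⟨g w, hmaps w w.2⟩
  have hG : Function.Injective G := fun x y hxy =>
    Subtype.ext (hinj x.2 y.2 (congrArg Subtype.val hxy))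
  let e : Equiv.Perm S := Equiv.ofBijective G (Finite.injective_iff_bijective.1 hG)
  obtain ⟨hσ, hτ, hc⟩ := h (fun x y => ∃ (hx : x ∈ S) (hy : y ∈ S), e.SameCycle ⟨x, hx⟩ ⟨y, hy⟩)
    (fun w hw => ⟨hw, hw, .refl _ _⟩) (fun ⟨hx, hy, h⟩ => ⟨hy, hx, h.symm⟩)
    (fun ⟨hx, _, h⟩ ⟨_, hz, h'⟩ => ⟨hx, hz, h.trans h'⟩)
    (fun w hw => ⟨hw, hmaps w hw, 1, rfl⟩)
  obtain ⟨m, -, hm⟩ := hc.exists_pow_eq'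
  refine ⟨m, ?_⟩
  have hval : ∀ (m : ℕ) (x : S), ((e ^ m) x : A) = g^[m] x := by
    intro m
    induction m with
    | zero => intro x; rfl
    | succ m ih => intro x; rw [pow_succ, Equiv.Perm.mul_apply, ih, Function.iterate_succ_apply]; rfl
  rw [← hval m ⟨σ, hσ⟩, hm]

theorem stmt10 {n : ℕ} (hn : 1 ≤ n)
    (N : Finset (List Bool))
    (hNneck : ∀ α ∈ N, α.length = n ∧ IsNecklace α)
    (hroot : List.replicate n false ∈ N)
    (hclosed : ∀ α ∈ N, α ≠ List.replicate n false → ∀ j, j < n →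
      α[j]? = some true → (∀ i, j < i → i < n → α[i]? = some false) →
      ∀ β, (∃ i : ℕ, β = (α.set j false).rotate i) → IsNecklace β → β ∈ N) :
    (∀ w ∈ SN N, gLastOne (SN N) w ∈ SN N) ∧
    ∀ σ ∈ SN N, ∀ τ ∈ SN N, ∃ m : ℕ, (gLastOne (SN N))^[m] σ = τ := by
  have hlen : ∀ w ∈ SN N, w.length = n := by
    intro w hw
    simp only [SN, rotClass, Finset.mem_biUnion, List.mem_toFinset, List.mem_map] at hw
    obtain ⟨α, hα, i, -, rfl⟩ := hw
    rw [List.length_rotate, (hNneck α hα).1]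
  have hne : ∀ w : List Bool, w.length = n → w ≠ [] := by
    rintro w hw rfl
    simp at hw; omega
  have hN : ∀ w ∈ SN N, ∃ α ∈ N, α ~r w := fun w hw =>
    (mem_SN_iff (hne w (hlen w hw))).1 hw
  have hrot : ∀ w ∈ SN N, ∀ v, w ~r v → v ∈ SN N := by
    intro w hw v hv
    obtain ⟨α, hα, h⟩ := hN w hw
    exact (mem_SN_iff (hne v (hv.perm.length_eq ▸ hlen w hw))).2 ⟨α, hα, h.trans hv⟩
  have hdown : ∀ u, IsNecklace (u ++ [true]) → u ++ [true] ∈ SN N → u ++ [false] ∈ SN N := by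
    intro u hu hS
    have hl := hlen _ hS
    simp only [List.length_append, List.length_singleton] at hl
    obtain ⟨α, hα, h⟩ := hN _ hS
    obtain rfl := (hNneck α hα).2.eq_of_isRotated hu h
    obtain ⟨i, hi⟩ := exists_isNecklace_rotate (u ++ [false])
    refine (mem_SN_iff (by simp)).2 ⟨_, hclosed _ hα ?_ u.length (by omega) (by simp)
      (fun i _ _ => by omega) _ ⟨i, by simp⟩ hi, .symm ⟨i, rfl⟩⟩
    intro h0
    have : true ∈ List.replicate n false := h0 ▸ (by simp)
    simp at this
  have hmem := gLastOne_mem hn hlen hrot hdown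
  refine ⟨hmem, fun σ hσ τ hτ =>
    exists_iterate_eq_of_injOn hmem (gLastOne_injOn hn hlen hrot hdown) ?_⟩
  intro E hrefl hsymm htrans hg
  have hstep := related_rotate_of_related_gLastOne hlen hrot hdown hrefl hsymm htrans hg
  have hclass : ∀ w ∈ SN N, ∀ v, w ~r v → E w v := by
    rintro w hw v ⟨i, rfl⟩
    induction i with
    | zero => simpa using hrefl w hw
    | succ i ih =>
      rw [← List.rotate_rotate]
      exact htrans ih (hstep _ (hrot w hw _ ⟨i, rfl⟩))
  have hzero : ∀ k, ∀ w ∈ SN N, w.count true = k → E w (List.replicate n false) := by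
    intro k
    induction k using Nat.strong_induction_on with
    | _ k ih =>
    intro w hw hk
    obtain ⟨α, hα, h⟩ := hN w hw
    have hwα := hclass w hw α h.symm
    by_cases h0 : α = List.replicate n false
    · rwa [h0] at hwα
    obtain ⟨u, rfl⟩ := (hNneck α hα).2.exists_eq_append_true hn (hNneck α hα).1 h0
    have hS := hrot w hw _ h.symm
    have hr : w ~r (true :: u) := h.symm.trans ⟨u.length, by simp⟩
    have h1 := hg _ (hrot w hw _ hr)
    rw [gLastOne_cons hrot hdown (hrot w hw _ hr), if_pos ⟨(hNneck _ hα).2, hS⟩] at h1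
    refine htrans (hclass w hw _ hr) (htrans h1 (ih _ ?_ _ (hdown u (hNneck _ hα).2 hS) rfl))
    rw [← hk, hr.perm.count_eq]
    simp
  exact htrans (hzero _ σ hσ rfl) (hsymm (hzero _ τ hτ rfl))
end
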